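/- For every fixed y ∈ [0,1]³, the remainder of the image expansion of the cube Green's function, R□₂₇(x,y) = Σ_{n∈ℤ³, max|nᵢ|≥2} Σ_{m∈{0,1}³} (−1)^{m₁+m₂+m₃}/(4π|x − y_{n,m}|) (summed in blocks over n), converges for all x in the open enlarged cube (−1,2)³ and defines a function of x that is harmonic on (−1,2)³. -/

import Mathlib

open scoped Real

noncomputable section

/-- Three-dimensional Euclidean space. -/
abbrev E3 := EuclideanSpace ℝ (Fin 3)

/-- The image point `y_{n,m}` of a source `y` in the method-of-images representation
for the unit cube. -/
def imgPt (y : E3) (n : Fin 3 → ℤ) (m : Fin 3 → ℕ) : E3 :=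
  (WithLp.equiv 2 (Fin 3 → ℝ)).symm (fun i => (-1 : ℝ) ^ (m i) * y i + 2 * (n i : ℝ))

/-- The signed eight-term image block
`Σ_{m∈{0,1}³} (−1)^{m₁+m₂+m₃} / (4π|x − y_{n,m}|)`. -/
def imageBlock (y : E3) (n : Fin 3 → ℤ) (x : E3) : ℝ :=
  ∑ m : Fin 3 → Fin 2,
    (-1 : ℝ) ^ ((m 0 : ℕ) + (m 1 : ℕ) + (m 2 : ℕ)) *
      (1 / (4 * π * ‖x - imgPt y n (fun i => (m i : ℕ))‖))

/-- The index set of the regular remainder: `n ∈ ℤ³` with `max(|n₁|,|n₂|,|n₃|) ≥ 2`. -/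
def RemIdx : Type := {n : Fin 3 → ℤ // 2 ≤ max |n 0| (max |n 1| |n 2|)}

/-- The regular remainder `R□₂₇(x,y)` of the image expansion of the cube Green's
function, summed in blocks over `n`. -/
def R27 (y : E3) (x : E3) : ℝ := ∑' n : RemIdx, imageBlock y n.1 x

/-- The Laplacian of `f : ℝ³ → ℝ` at `x`: the sum of the three pure second
partial derivatives. -/
def lap3 (f : E3 → ℝ) (x : E3) : ℝ :=
  ∑ i : Fin 3,
    fderiv ℝ (fun y => fderiv ℝ f y (EuclideanSpace.single i 1)) x (EuclideanSpace.single i 1)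

/-- `f` is harmonic on the open set `U ⊆ ℝ³`. -/
def HarmonicOn3 (f : E3 → ℝ) (U : Set E3) : Prop :=
  ContDiffOn ℝ 2 f U ∧ ∀ x ∈ U, lap3 f x = 0


theorem summable_norm_intVec_inv_pow_four :
    Summable fun n : Fin 3 → ℤ => ‖n‖⁻¹ ^ 4 := by
  let b := Pi.basisFun ℝ (Fin 3)
  let L := Submodule.span ℤ (Set.range b)
  have hr : Module.finrank ℤ L = 3 := by rw [ZLattice.rank ℝ L]; simp
  have hs := ZLattice.summable_norm_pow_inv L 4 (by omega)
  have hmem (n : Fin 3 → ℤ) : (fun i => (n i : ℝ)) ∈ L := by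
    refine (b.mem_span_iff_repr_mem ℤ _).2 ?_
    exact fun i => ⟨n i, by simp [b]⟩
  have hinj : Function.Injective fun n : Fin 3 → ℤ => (⟨_, hmem n⟩ : L) := by
    intro n m h
    ext i
    have := congrFun (congrArg Subtype.val h) i
    simpa using this
  refine (hs.comp_injective hinj).congr fun n => ?_
  have : ‖(fun i => (n i : ℝ))‖ = ‖n‖ := by
    simp only [Pi.norm_def]
    congr! 3 with i
  simp [this]

theorem iteratedFDeriv_inv_norm_smul {E : Type*} [NormedAddCommGroup E] [NormedSpace ℝ E]
    {t : ℝ} (ht : 0 < t) (k : ℕ) (w : E) :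
    iteratedFDeriv ℝ k (fun z : E => ‖z‖⁻¹) (t • w) =
      (t⁻¹ ^ (k + 1)) • iteratedFDeriv ℝ k (fun z : E => ‖z‖⁻¹) w := by
  induction k generalizing w with
  | zero =>
    ext m
    simp [norm_smul, abs_of_pos ht, mul_comm]
  | succ k ih =>
    have h : (fun w => iteratedFDeriv ℝ k (fun z : E => ‖z‖⁻¹) (t • w)) =
      (t⁻¹ ^ (k + 1)) • iteratedFDeriv ℝ k (fun z : E => ‖z‖⁻¹) := funext ih
    have h2 := congrArg (fun f => fderiv ℝ f w) h
    have h3 := congrFun (fderiv_const_smul_field (𝕜 := ℝ) (t⁻¹ ^ (k + 1))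
      (f := iteratedFDeriv ℝ k (fun z : E => ‖z‖⁻¹))) w
    simp only [fderiv_comp_smul, h3] at h2
    ext m
    simp only [iteratedFDeriv_succ_apply_left, smul_apply]
    have h4 := congrArg (fun A => A (m 0) (Fin.tail m)) h2
    simp only [smul_apply, Pi.smul_apply, smul_eq_mul] at h4 ⊢
    rw [pow_succ, mul_right_comm, ← h4]
    field_simp

theorem contDiffAt_inv_norm {E : Type*} [NormedAddCommGroup E] [InnerProductSpace ℝ E]
    {n : WithTop ℕ∞} {z : E} (hz : z ≠ 0) :
    ContDiffAt ℝ n (fun z : E => ‖z‖⁻¹) z :=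
  (contDiffAt_norm ℝ hz).inv (norm_ne_zero_iff.2 hz)

theorem exists_norm_iteratedFDeriv_inv_norm_le (E : Type*) [NormedAddCommGroup E]
    [InnerProductSpace ℝ E] [FiniteDimensional ℝ E] (k : ℕ) :
    ∃ C, 0 ≤ C ∧ ∀ z : E, z ≠ 0 →
      ‖iteratedFDeriv ℝ k (fun z : E => ‖z‖⁻¹) z‖ ≤ C * ‖z‖⁻¹ ^ (k + 1) := by
  have hc : ContinuousOn (iteratedFDeriv ℝ k (fun z : E => ‖z‖⁻¹)) (Metric.sphere 0 1) := by
    intro z hz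
    have hz0 : z ≠ 0 := ne_zero_of_mem_unit_sphere ⟨z, hz⟩
    exact ((contDiffAt_inv_norm hz0).differentiableAt_iteratedFDeriv
      (n := (k + 1 : ℕ)) (by exact_mod_cast k.lt_succ_self)).continuousAt.continuousWithinAt
  obtain ⟨C, hC⟩ := (isCompact_sphere (0 : E) 1).exists_bound_of_continuousOn hc
  refine ⟨max C 0, le_max_right _ _, fun z hz => ?_⟩
  have hpos : 0 < ‖z‖ := norm_pos_iff.2 hz
  have hu : ‖z‖⁻¹ • z ∈ Metric.sphere (0 : E) 1 := by
    simp [norm_smul, hpos.ne']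
  have h := iteratedFDeriv_inv_norm_smul hpos k (‖z‖⁻¹ • z)
  rw [smul_inv_smul₀ hpos.ne'] at h
  rw [h, norm_smul, mul_comm, norm_pow, norm_inv, norm_norm]
  gcongr
  exact (hC _ hu).trans (le_max_left _ _)

theorem hasFDerivAt_inv_norm {E : Type*} [NormedAddCommGroup E] [InnerProductSpace ℝ E]
    {z : E} (hz : z ≠ 0) :
    HasFDerivAt (fun z : E => ‖z‖⁻¹) (-(‖z‖⁻¹ ^ 3) • innerSL ℝ z) z := by
  have hpos : 0 < ‖z‖ := norm_pos_iff.2 hz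
  have h1 : HasFDerivAt (fun z : E => ‖z‖ ^ 2) (2 • innerSL ℝ z) z :=
    (hasStrictFDerivAt_norm_sq z).hasFDerivAt
  have h2 := (hasDerivAt_inv (by positivity)).comp_hasFDerivAt z (h1.sqrt (by positivity))
  simp only [Function.comp_def, Real.sqrt_sq (norm_nonneg _)] at h2
  convert! h2 using 1
  ext v
  simp
  field_simp

theorem iteratedFDeriv_two_inv_norm_apply {E : Type*} [NormedAddCommGroup E]
    [InnerProductSpace ℝ E] {z : E} (hz : z ≠ 0) (v : E) :
    iteratedFDeriv ℝ 2 (fun z : E => ‖z‖⁻¹) z ![v, v] =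
      3 * ‖z‖⁻¹ ^ 5 * inner ℝ z v ^ 2 - ‖z‖⁻¹ ^ 3 * ‖v‖ ^ 2 := by
  have he : fderiv ℝ (fun z : E => ‖z‖⁻¹) =ᶠ[nhds z]
      fun z => -(‖z‖⁻¹ ^ 3) • innerSL ℝ z := by
    filter_upwards [isOpen_ne.mem_nhds hz] with w hw
    exact (hasFDerivAt_inv_norm hw).fderiv
  have h := ((hasFDerivAt_inv_norm hz).pow 3).neg.smul (innerSL ℝ (E := E)).hasFDerivAt
  rw [iteratedFDeriv_two_apply, he.fderiv_eq]
  erw [h.fderiv]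
  simp
  rw [innerSL_apply_apply, innerSL_apply_apply, real_inner_self_eq_norm_sq]
  ring

/-- The symmetric difference of `g` with step `h`. -/
def centralDiff (h : E3) (g : E3 → ℝ) (x : E3) : ℝ := g (x + h) - g (x - h)

/-- `g` is of class `C³` with vanishing Laplacian on `V`, and its derivatives of order
`a, …, 3` are bounded by `K` there. -/
structure HarmonicWithBounds (g : E3 → ℝ) (V : Set E3) (K : ℝ) (a : ℕ) : Prop where
  contDiffAt : ∀ x ∈ V, ContDiffAt ℝ 3 g x
  bound : ∀ j, a ≤ j → j ≤ 3 → ∀ x ∈ V, ‖iteratedFDeriv ℝ j g x‖ ≤ K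
  laplacian : ∀ x ∈ V, ∑ i : Fin 3,
    iteratedFDeriv ℝ 2 g x ![EuclideanSpace.single i 1, EuclideanSpace.single i 1] = 0

theorem iteratedFDeriv_centralDiff {g : E3 → ℝ} {h x : E3} {k : ℕ}
    (h₁ : ContDiffAt ℝ k g (x + h)) (h₂ : ContDiffAt ℝ k g (x - h)) :
    iteratedFDeriv ℝ k (centralDiff h g) x =
      iteratedFDeriv ℝ k g (x + h) - iteratedFDeriv ℝ k g (x - h) := by
  unfold centralDiff
  rw [fun_iteratedFDeriv_sub_apply (f := fun x => g (x + h)) (g := fun x => g (x - h))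
      (h₁.comp x (by fun_prop)) (h₂.comp x (by fun_prop)), iteratedFDeriv_comp_add_right,
    iteratedFDeriv_comp_sub]

theorem HarmonicWithBounds.centralDiff {g : E3 → ℝ} {V V' : Set E3} {K : ℝ} {a : ℕ} {h : E3}
    (ha : a < 3) (hg : HarmonicWithBounds g V K (a + 1)) (hV : Convex ℝ V) (hh : ‖h‖ ≤ 1)
    (hVV' : ∀ x ∈ V', x + h ∈ V ∧ x - h ∈ V) :
    HarmonicWithBounds (centralDiff h g) V' (2 * K) a := by
  have hD {k : ℕ} (hk : k ≤ 3) {x : E3} (hx : x ∈ V') :=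
    iteratedFDeriv_centralDiff (k := k)
      ((hg.contDiffAt _ (hVV' x hx).1).of_le (by exact_mod_cast hk))
      ((hg.contDiffAt _ (hVV' x hx).2).of_le (by exact_mod_cast hk))
  refine ⟨fun x hx => ?_, fun j haj hj x hx => ?_, fun x hx => ?_⟩
  · exact ((hg.contDiffAt _ (hVV' x hx).1).comp x (by fun_prop)).sub
      ((hg.contDiffAt _ (hVV' x hx).2).comp x (by fun_prop))
  · rw [hD hj hx]
    obtain ⟨hp, hm⟩ := hVV' x hx
    rcases haj.eq_or_lt with rfl | haj
    · have hb := hV.norm_image_sub_le_of_norm_fderiv_le (𝕜 := ℝ) (C := K)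
        (fun z hz => (hg.contDiffAt z hz).differentiableAt_iteratedFDeriv
          (m := a) (by exact_mod_cast ha))
        (fun z hz => norm_fderiv_iteratedFDeriv.trans_le (hg.bound _ le_rfl ha z hz)) hm hp
      have hK : 0 ≤ K := (norm_nonneg _).trans (hg.bound _ le_rfl ha _ hp)
      have h2 : ‖x + h - (x - h)‖ ≤ 2 := by
        rw [show x + h - (x - h) = h + h by abel]
        linarith [norm_add_le h h]
      nlinarith
    · linarith [norm_sub_le (iteratedFDeriv ℝ j g (x + h)) (iteratedFDeriv ℝ j g (x - h)),
        hg.bound j haj hj _ hp, hg.bound j haj hj _ hm]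
  · simp only [hD (k := 2) (by norm_num) hx, sub_apply,
      Finset.sum_sub_distrib, hg.laplacian _ (hVV' x hx).1, hg.laplacian _ (hVV' x hx).2, sub_zero]

theorem HarmonicWithBounds.const_smul {g : E3 → ℝ} {V : Set E3} {K : ℝ} {a : ℕ}
    (hg : HarmonicWithBounds g V K a) (c : ℝ) :
    HarmonicWithBounds (c • g) V (|c| * K) a := by
  have hD {k : ℕ} (hk : k ≤ 3) {x : E3} (hx : x ∈ V) :=
    iteratedFDeriv_const_smul_apply (i := k) (a := c)
      ((hg.contDiffAt _ hx).of_le (by exact_mod_cast hk))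
  refine ⟨fun x hx => (hg.contDiffAt x hx).const_smul c, fun j haj hj x hx => ?_, fun x hx => ?_⟩
  · rw [hD hj hx, norm_smul, Real.norm_eq_abs]
    gcongr
    exact hg.bound j haj hj x hx
  · simp only [hD (k := 2) (by norm_num) hx, smul_apply,
      ← Finset.smul_sum, hg.laplacian x hx, smul_zero]

theorem harmonicWithBounds_inv_norm_sub :
    ∃ C, 0 ≤ C ∧ ∀ (c : E3) (V : Set E3) (r : ℝ), 0 < r → (∀ x ∈ V, r ≤ ‖x - c‖) →
      HarmonicWithBounds (fun x => ‖x - c‖⁻¹) V (C * r⁻¹ ^ 4) 3 := by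
  obtain ⟨C, hC0, hC⟩ := exists_norm_iteratedFDeriv_inv_norm_le E3 3
  refine ⟨C, hC0, fun c V r hr hV => ?_⟩
  have hne (x : E3) (hx : x ∈ V) : x - c ≠ 0 :=
    norm_pos_iff.1 (hr.trans_le (hV x hx))
  have hD (k : ℕ) (x : E3) := iteratedFDeriv_comp_sub (𝕜 := ℝ) (f := fun z : E3 => ‖z‖⁻¹) k c x
  refine ⟨fun x hx => ?_, fun j haj hj x hx => ?_, fun x hx => ?_⟩
  · exact (contDiffAt_inv_norm (hne x hx)).comp x (f := fun x => x - c) (by fun_prop)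
  · obtain rfl : j = 3 := le_antisymm hj haj
    rw [hD]
    refine (hC _ (hne x hx)).trans ?_
    have := hV x hx
    gcongr
  · have hpos : 0 < ‖x - c‖ := norm_pos_iff.2 (hne x hx)
    have hn : ‖x - c‖ ^ 2 = (x - c) 0 ^ 2 + (x - c) 1 ^ 2 + (x - c) 2 ^ 2 := by
      simp [EuclideanSpace.norm_sq_eq, Fin.sum_univ_three]
    simp only [hD, iteratedFDeriv_two_inv_norm_apply (hne x hx), Fin.sum_univ_three,
      EuclideanSpace.inner_single_right, PiLp.norm_single]
    simp only [one_mul, norm_one, conj_trivial]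
    have : ‖x - c‖⁻¹ ^ 5 * ‖x - c‖ ^ 2 = ‖x - c‖⁻¹ ^ 3 := by field_simp
    rw [hn] at this
    linear_combination 3 * this

section Tsum

variable {ι E F : Type*} [NormedAddCommGroup E] [NormedSpace ℝ E] [NormedAddCommGroup F]
  [NormedSpace ℝ F] [CompleteSpace F] {g : ι → E → F} {U : Set E} {u : ι → ℝ}

theorem hasFDerivAt_tsum_of_convex (hU : IsOpen U) (hUc : Convex ℝ U) (hu : Summable u)
    (hg : ∀ i, ∀ x ∈ U, DifferentiableAt ℝ (g i) x) (hb₀ : ∀ i, ∀ x ∈ U, ‖g i x‖ ≤ u i)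
    (hb₁ : ∀ i, ∀ x ∈ U, ‖fderiv ℝ (g i) x‖ ≤ u i) {x : E} (hx : x ∈ U) :
    HasFDerivAt (fun x => ∑' i, g i x) (∑' i, fderiv ℝ (g i) x) x :=
  hasFDerivAt_tsum_of_isPreconnected hu hU hUc.isPreconnected
    (fun i x hx => (hg i x hx).hasFDerivAt) hb₁ hx
    (.of_norm_bounded hu fun i => hb₀ i x hx) hx

theorem hasFDerivAt_fderiv_tsum_of_convex (hU : IsOpen U) (hUc : Convex ℝ U) (hu : Summable u)
    (hg : ∀ i, ∀ x ∈ U, ContDiffAt ℝ 2 (g i) x) (hb₀ : ∀ i, ∀ x ∈ U, ‖g i x‖ ≤ u i)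
    (hb₁ : ∀ i, ∀ x ∈ U, ‖fderiv ℝ (g i) x‖ ≤ u i)
    (hb₂ : ∀ i, ∀ x ∈ U, ‖fderiv ℝ (fderiv ℝ (g i)) x‖ ≤ u i) {x : E} (hx : x ∈ U) :
    HasFDerivAt (fderiv ℝ fun x => ∑' i, g i x) (∑' i, fderiv ℝ (fderiv ℝ (g i)) x) x := by
  have hd (i : ι) (x : E) (hx : x ∈ U) : DifferentiableAt ℝ (fderiv ℝ (g i)) x :=
    ((hg i x hx).fderiv_right (m := 1) (by norm_num)).differentiableAt (by norm_num)
  refine (hasFDerivAt_tsum_of_convex hU hUc hu hd hb₁ hb₂ hx).congr_of_eventuallyEq ?_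
  filter_upwards [hU.mem_nhds hx] with w hw
  exact (hasFDerivAt_tsum_of_convex hU hUc hu
    (fun i x hx => (hg i x hx).differentiableAt (by norm_num)) hb₀ hb₁ hw).fderiv

theorem contDiffOn_two_tsum_of_convex (hU : IsOpen U) (hUc : Convex ℝ U) (hu : Summable u)
    (hg : ∀ i, ∀ x ∈ U, ContDiffAt ℝ 2 (g i) x) (hb₀ : ∀ i, ∀ x ∈ U, ‖g i x‖ ≤ u i)
    (hb₁ : ∀ i, ∀ x ∈ U, ‖fderiv ℝ (g i) x‖ ≤ u i)
    (hb₂ : ∀ i, ∀ x ∈ U, ‖fderiv ℝ (fderiv ℝ (g i)) x‖ ≤ u i) :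
    ContDiffOn ℝ 2 (fun x => ∑' i, g i x) U := by
  have hF (x : E) (hx : x ∈ U) := hasFDerivAt_fderiv_tsum_of_convex hU hUc hu hg hb₀ hb₁ hb₂ hx
  rw [← one_add_one_eq_two, contDiffOn_succ_iff_fderiv_of_isOpen hU]
  refine ⟨fun x hx => ?_, by simp, ?_⟩
  · exact (hasFDerivAt_tsum_of_convex hU hUc hu
      (fun i x hx => (hg i x hx).differentiableAt (by norm_num))
      hb₀ hb₁ hx).differentiableAt.differentiableWithinAt
  rw [← zero_add 1, contDiffOn_succ_iff_fderiv_of_isOpen hU]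
  refine ⟨fun x hx => (hF x hx).differentiableAt.differentiableWithinAt, by simp, ?_⟩
  rw [contDiffOn_zero]
  refine ContinuousOn.congr (continuousOn_tsum (fun i x hx => ?_) hu hb₂)
    fun x hx => (hF x hx).fderiv
  exact (((hg i x hx).fderiv_right (m := 1) (by norm_num)).fderiv_right
    (m := 0) (by norm_num)).continuousAt.continuousWithinAt

end Tsum

theorem ContinuousLinearMap.hasSum_apply_apply_of_norm_le {ι E : Type*} [NormedAddCommGroup E]
    [NormedSpace ℝ E] {A : ι → E →L[ℝ] E →L[ℝ] ℝ} {u : ι → ℝ} (hu : Summable u)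
    (hA : ∀ i, ‖A i‖ ≤ u i) (v w : E) : HasSum (fun i => A i v w) ((∑' i, A i) v w) :=
  ((ContinuousLinearMap.apply ℝ ℝ w).comp
    (ContinuousLinearMap.apply ℝ (E →L[ℝ] ℝ) v)).hasSum (Summable.of_norm_bounded hu hA).hasSum

theorem lap3_eq_of_hasFDerivAt_fderiv {f : E3 → ℝ} {x : E3} {B : E3 →L[ℝ] E3 →L[ℝ] ℝ}
    (h : HasFDerivAt (fderiv ℝ f) B x) :
    lap3 f x = ∑ i : Fin 3, B (EuclideanSpace.single i 1) (EuclideanSpace.single i 1) := by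
  refine Finset.sum_congr rfl fun i _ => ?_
  rw [(h.clm_apply (hasFDerivAt_const (EuclideanSpace.single i (1 : ℝ)) x)).fderiv]
  simp

namespace HarmonicWithBounds

variable {g : E3 → ℝ} {V : Set E3} {K : ℝ} {x : E3}

theorem norm_le (hg : HarmonicWithBounds g V K 0) (hx : x ∈ V) : ‖g x‖ ≤ K := by
  have h := hg.bound 0 le_rfl (Nat.zero_le 3) x hx
  rwa [norm_iteratedFDeriv_zero] at h

theorem norm_fderiv_le (hg : HarmonicWithBounds g V K 0) (hx : x ∈ V) :
    ‖fderiv ℝ g x‖ ≤ K := by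
  have h := hg.bound 1 (Nat.zero_le 1) (by decide) x hx
  rwa [norm_iteratedFDeriv_one] at h

theorem norm_fderiv_fderiv_le (hg : HarmonicWithBounds g V K 0) (hx : x ∈ V) :
    ‖fderiv ℝ (fderiv ℝ g) x‖ ≤ K := by
  have h := hg.bound 2 (Nat.zero_le 2) (by decide) x hx
  rwa [← norm_iteratedFDeriv_fderiv, norm_iteratedFDeriv_one] at h

theorem contDiffAt_two {a : ℕ} (hg : HarmonicWithBounds g V K a) (hx : x ∈ V) :
    ContDiffAt ℝ 2 g x :=
  (hg.contDiffAt x hx).of_le (by exact_mod_cast (by decide : 2 ≤ 3))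

theorem sum_fderiv_fderiv {a : ℕ} (hg : HarmonicWithBounds g V K a) (hx : x ∈ V) :
    ∑ k : Fin 3, fderiv ℝ (fderiv ℝ g) x (EuclideanSpace.single k 1)
      (EuclideanSpace.single k 1) = 0 := by
  have h := hg.laplacian x hx
  simp only [iteratedFDeriv_two_apply] at h
  exact h

variable {ι : Type*} {f : ι → E3 → ℝ} {u : ι → ℝ}

theorem hasSum (hu : Summable u) (hf : ∀ i, HarmonicWithBounds (f i) V (u i) 0) (hx : x ∈ V) :
    HasSum (fun i => f i x) (∑' i, f i x) :=
  (Summable.of_norm_bounded hu fun i => (hf i).norm_le hx).hasSum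

theorem contDiffOn_tsum (hV : IsOpen V) (hVc : Convex ℝ V) (hu : Summable u)
    (hf : ∀ i, HarmonicWithBounds (f i) V (u i) 0) : ContDiffOn ℝ 2 (fun x => ∑' i, f i x) V :=
  contDiffOn_two_tsum_of_convex hV hVc hu (fun i _ => (hf i).contDiffAt_two)
    (fun i _ => (hf i).norm_le) (fun i _ => (hf i).norm_fderiv_le)
    fun i _ => (hf i).norm_fderiv_fderiv_le

theorem sum_tsum_fderiv_fderiv (hu : Summable u)
    (hf : ∀ i, HarmonicWithBounds (f i) V (u i) 0) (hx : x ∈ V) :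
    ∑ k : Fin 3, (∑' i, fderiv ℝ (fderiv ℝ (f i)) x) (EuclideanSpace.single k 1)
      (EuclideanSpace.single k 1) = 0 := by
  have hsum := hasSum_sum fun k (_ : k ∈ Finset.univ) =>
    ContinuousLinearMap.hasSum_apply_apply_of_norm_le hu
      (fun i => (hf i).norm_fderiv_fderiv_le hx) (EuclideanSpace.single (k : Fin 3) (1 : ℝ))
      (EuclideanSpace.single k 1)
  simp only [fun i => (hf i).sum_fderiv_fderiv hx] at hsum
  exact hsum.unique hasSum_zero

theorem lap3_tsum (hV : IsOpen V) (hVc : Convex ℝ V) (hu : Summable u)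
    (hf : ∀ i, HarmonicWithBounds (f i) V (u i) 0) (hx : x ∈ V) :
    lap3 (fun x => ∑' i, f i x) x = 0 :=
  (lap3_eq_of_hasFDerivAt_fderiv (hasFDerivAt_fderiv_tsum_of_convex hV hVc hu
    (fun i _ => (hf i).contDiffAt_two) (fun i _ => (hf i).norm_le)
    (fun i _ => (hf i).norm_fderiv_le) (fun i _ => (hf i).norm_fderiv_fderiv_le) hx)).trans
    (sum_tsum_fderiv_fderiv hu hf hx)

end HarmonicWithBounds

theorem harmonicOn3_tsum {ι : Type*} {g : ι → E3 → ℝ} {U : Set E3} {u : ι → ℝ}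
    (hU : IsOpen U) (hUc : Convex ℝ U) (hu : Summable u)
    (hg : ∀ i, HarmonicWithBounds (g i) U (u i) 0) :
    (∀ x ∈ U, HasSum (fun i => g i x) (∑' i, g i x)) ∧
      HarmonicOn3 (fun x => ∑' i, g i x) U :=
  ⟨fun _ hx => HarmonicWithBounds.hasSum hu hg hx,
    HarmonicWithBounds.contDiffOn_tsum hU hUc hu hg,
    fun _ hx => HarmonicWithBounds.lap3_tsum hU hUc hu hg hx⟩

/-- The box in which the first `k` coordinates range over `(-1,2)` and the others over
`(-2,3)`. -/
def mixedBox (k : ℕ) : Set E3 :=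
  {x | ∀ i : Fin 3, x i ∈ if (i : ℕ) < k then Set.Ioo (-1 : ℝ) 2 else Set.Ioo (-2 : ℝ) 3}

theorem convex_mixedBox (k : ℕ) : Convex ℝ (mixedBox k) := by
  have : mixedBox k = ⋂ i : Fin 3, (EuclideanSpace.proj (𝕜 := ℝ) i) ⁻¹'
      (if (i : ℕ) < k then Set.Ioo (-1 : ℝ) 2 else Set.Ioo (-2 : ℝ) 3) := by
    ext x; simp [mixedBox]
  rw [this]
  refine convex_iInter fun i =>
    Convex.linear_preimage ?_ (EuclideanSpace.proj (𝕜 := ℝ) i).toLinearMap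
  split_ifs <;> exact convex_Ioo _ _

theorem mixedBox_three : mixedBox 3 = {x : E3 | ∀ i, x i ∈ Set.Ioo (-1 : ℝ) 2} := by
  ext x
  simp [mixedBox]

theorem isOpen_mixedBox_three : IsOpen (mixedBox 3) := by
  rw [mixedBox_three, Set.ofPred_forall]
  exact isOpen_iInter_of_finite fun i => isOpen_Ioo.preimage (by fun_prop)

theorem mixedBox_succ_add_sub_mem {y : E3} (hy : ∀ i, y i ∈ Set.Icc (0 : ℝ) 1) (k : Fin 3)
    {x : E3} (hx : x ∈ mixedBox (k + 1)) :
    x + EuclideanSpace.single k (y k) ∈ mixedBox k ∧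
      x - EuclideanSpace.single k (y k) ∈ mixedBox k := by
  have hyk := hy k
  simp only [Set.mem_Icc] at hyk
  constructor <;> intro i <;> have hxi := hx i <;> by_cases hik : i = k
  · subst hik
    simp at hxi ⊢
    constructor <;> linarith
  · have : (i : ℕ) ≠ k := Fin.val_ne_of_ne hik
    have h2 : (i : ℕ) < k + 1 ↔ (i : ℕ) < k := by omega
    simpa [hik, h2] using hxi
  · subst hik
    simp at hxi ⊢
    constructor <;> linarith
  · have : (i : ℕ) ≠ k := Fin.val_ne_of_ne hik
    have h2 : (i : ℕ) < k + 1 ↔ (i : ℕ) < k := by omega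
    simpa [hik, h2] using hxi

/-- The lattice point `2n`. -/
def doubledPt (n : Fin 3 → ℤ) : E3 := WithLp.toLp 2 fun i => 2 * (n i : ℝ)

theorem norm_div_two_le_norm_sub_doubledPt {n : Fin 3 → ℤ}
    (hn : 2 ≤ max |n 0| (max |n 1| |n 2|)) {x : E3} (hx : x ∈ mixedBox 0) :
    ‖n‖ / 2 ≤ ‖x - doubledPt n‖ := by
  obtain ⟨j, hj⟩ := Finite.exists_max fun i => |n i|
  have hj2 : (2 : ℝ) ≤ |(n j : ℝ)| := by
    have : 2 ≤ |n j| := hn.trans (max_le (hj 0) (max_le (hj 1) (hj 2)))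
    exact_mod_cast this
  have hnorm : ‖n‖ ≤ |(n j : ℝ)| := by
    refine (pi_norm_le_iff_of_nonneg (abs_nonneg _)).2 fun i => ?_
    rw [Int.norm_eq_abs]
    exact_mod_cast hj i
  have hc : |x j - 2 * n j| ≤ ‖x - doubledPt n‖ := by
    simpa [doubledPt] using PiLp.norm_apply_le (x - doubledPt n) j
  have hxj : -2 < x j ∧ x j < 3 := by simpa using hx j
  have hlow : |(n j : ℝ)| / 2 ≤ |x j - 2 * n j| := by
    rcases abs_cases (n j : ℝ) with h | h <;> rcases abs_cases (x j - 2 * n j) with h' | h' <;>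
      linarith
  linarith

theorem sum_fin_three_fin_two {M : Type*} [AddCommMonoid M] (F : (Fin 3 → Fin 2) → M) :
    ∑ m, F m = ∑ a, ∑ b, ∑ c, F ![a, b, c] := by
  rw [← Fintype.sum_prod_type', ← Fintype.sum_prod_type']
  let e : (Fin 2 × Fin 2) × Fin 2 ≃ (Fin 3 → Fin 2) :=
    { toFun := fun p => ![p.1.1, p.1.2, p.2]
      invFun := fun m => ((m 0, m 1), m 2)
      left_inv := fun p => rfl
      right_inv := fun m => by ext i; fin_cases i <;> rfl }
  exact (Fintype.sum_equiv e _ _ fun p => rfl).symm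

theorem imageBlock_eq_centralDiff (y : E3) (n : Fin 3 → ℤ) :
    imageBlock y n = (-(4 * π)⁻¹) •
      centralDiff (EuclideanSpace.single 2 (y 2)) (centralDiff (EuclideanSpace.single 1 (y 1))
        (centralDiff (EuclideanSpace.single 0 (y 0)) fun x => ‖x - doubledPt n‖⁻¹)) := by
  ext x
  have key (a b c : Fin 2) : x - imgPt y n (fun i => ((![a, b, c] i : Fin 2) : ℕ)) =
      x - (-1 : ℝ) ^ (c : ℕ) • EuclideanSpace.single 2 (y 2)
        - (-1 : ℝ) ^ (b : ℕ) • EuclideanSpace.single 1 (y 1)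
        - (-1 : ℝ) ^ (a : ℕ) • EuclideanSpace.single 0 (y 0) - doubledPt n := by
    ext i
    fin_cases i <;> simp [imgPt, doubledPt] <;> ring
  simp only [imageBlock, sum_fin_three_fin_two, key]
  simp [Fin.sum_univ_two, centralDiff]
  ring

theorem harmonicWithBounds_imageBlock {y : E3} (hy : ∀ i, y i ∈ Set.Icc (0 : ℝ) 1) :
    ∃ C, ∀ n : RemIdx,
      HarmonicWithBounds (imageBlock y n.1) (mixedBox 3) (C * ‖n.1‖⁻¹ ^ 4) 0 := by
  obtain ⟨C, -, hC⟩ := harmonicWithBounds_inv_norm_sub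
  refine ⟨|(-(4 * π)⁻¹)| * (2 * (2 * (2 * (C * 2 ^ 4)))), fun n => ?_⟩
  have hn : 0 < ‖n.1‖ := by
    rw [norm_pos_iff]
    intro h
    have := n.2
    simp [h] at this
  have hsingle (k : Fin 3) : ‖(EuclideanSpace.single k (y k) : E3)‖ ≤ 1 := by
    rw [PiLp.norm_single, Real.norm_eq_abs, abs_le]
    constructor <;> linarith [(hy k).1, (hy k).2]
  have h₀ := hC (doubledPt n.1) (mixedBox 0) (‖n.1‖ / 2) (by positivity)
    fun x hx => norm_div_two_le_norm_sub_doubledPt n.2 hx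
  have h₁ := h₀.centralDiff (by norm_num) (convex_mixedBox 0) (hsingle 0)
    fun x hx => mixedBox_succ_add_sub_mem hy 0 hx
  have h₂ := h₁.centralDiff (by norm_num) (convex_mixedBox 1) (hsingle 1)
    fun x hx => mixedBox_succ_add_sub_mem hy 1 hx
  have h₃ := h₂.centralDiff (by norm_num) (convex_mixedBox 2) (hsingle 2)
    fun x hx => mixedBox_succ_add_sub_mem hy 2 hx
  have h₄ := h₃.const_smul (-(4 * π)⁻¹)
  rw [← imageBlock_eq_centralDiff] at h₄
  convert! h₄ using 1
  rw [inv_div]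
  ring

/-- For every fixed `y ∈ [0,1]³`, the remainder `R□₂₇(·,y)` of the image expansion
of the cube Green's function converges (in blocks over `n`) at every point of the
open enlarged cube `(−1,2)³` and defines a harmonic function there. -/
theorem remainder_harmonic (y : E3) (hy : ∀ i, y i ∈ Set.Icc (0 : ℝ) 1) :
    (∀ x ∈ {x : E3 | ∀ i, x i ∈ Set.Ioo (-1 : ℝ) 2},
      HasSum (fun n : RemIdx => imageBlock y n.1 x) (R27 y x)) ∧
    HarmonicOn3 (R27 y) {x : E3 | ∀ i, x i ∈ Set.Ioo (-1 : ℝ) 2} := by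
  obtain ⟨C, hC⟩ := harmonicWithBounds_imageBlock hy
  have hu : Summable fun n : RemIdx => C * ‖n.1‖⁻¹ ^ 4 :=
    (summable_norm_intVec_inv_pow_four.comp_injective Subtype.val_injective).mul_left C
  rw [← mixedBox_three]
  exact harmonicOn3_tsum isOpen_mixedBox_three (convex_mixedBox 3) hu hC

end
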